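/- arXiv:2201.02897 — 6 statements merged into one kernel-verified Lean document; each statement's English description precedes it below -/
import Mathlib

section
/- Let D be a dyadic grid in ℝⁿ and let Γ = {I_m}_{m=1}^∞ be a D-tower. Then top Γ = ⋃_{m=1}^∞ I_m is a product ∏_{k=1}^n F_k of n intervals, where each F_k is of one of the forms (-∞, a_k), [a_k, ∞), or (-∞, ∞) for some real a_k. -/
open Set

/-- The half-open axis-parallel cube `∏ i, [a i, a i + ℓ)` in `ℝⁿ`. -/
def cubeOf {n : ℕ} (a : Fin n → ℝ) (ℓ : ℝ) : Set (Fin n → ℝ) :=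
  {x | ∀ i, x i ∈ Set.Ico (a i) (a i + ℓ)}

/-- `Q` is a half-open axis-parallel cube of side length `ℓ`. -/
def HasSideLength {n : ℕ} (Q : Set (Fin n → ℝ)) (ℓ : ℝ) : Prop :=
  ∃ a, Q = cubeOf a ℓ

/-- A dyadic grid on `ℝⁿ`: for each `k : ℤ` the cubes of side length `2^k` partition `ℝⁿ`,
and every cube of side length `2^k` is the union of `2^n` cubes of side length `2^(k-1)`. -/
def IsDyadicGrid {n : ℕ} (D : Set (Set (Fin n → ℝ))) : Prop :=
  (∀ Q ∈ D, ∃ k : ℤ, HasSideLength Q ((2:ℝ) ^ k)) ∧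
  (∀ k : ℤ, ∀ x : Fin n → ℝ, ∃! Q, Q ∈ D ∧ HasSideLength Q ((2:ℝ) ^ k) ∧ x ∈ Q) ∧
  (∀ k : ℤ, ∀ Q ∈ D, HasSideLength Q ((2:ℝ) ^ k) →
    ∃ C : Finset (Set (Fin n → ℝ)), C.card = 2 ^ n ∧ ↑C ⊆ D ∧
      (∀ Q' ∈ C, HasSideLength Q' ((2:ℝ) ^ (k - 1))) ∧ Q = ⋃₀ ↑C)

/-- A `D`-tower: a nested sequence of cubes of `D` with `ℓ(I_m) = 2^m`, `m = 1, 2, 3, …`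
(indexed here by `m : ℕ` with `Γ m` of side length `2^(m+1)`). -/
def IsTower {n : ℕ} (D : Set (Set (Fin n → ℝ))) (Γ : ℕ → Set (Fin n → ℝ)) : Prop :=
  (∀ m, Γ m ∈ D) ∧ (∀ m, Γ m ⊆ Γ (m + 1)) ∧
  (∀ m : ℕ, HasSideLength (Γ m) ((2:ℝ) ^ (m + 1)))

/-- The top of a tower: the union of its cubes. -/
def towerTop {n : ℕ} (Γ : ℕ → Set (Fin n → ℝ)) : Set (Fin n → ℝ) := ⋃ m, Γ m

lemma aux_seq (u : ℕ → ℝ) (hu : ∀ m, u (m+1) = u m ∨ u m + 1 ≤ u (m+1)) :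
    (∃ N, ∀ m, N ≤ m → u m = u N) ∨ (∀ x, ∃ m, x < u m) := by
  by_cases h : ∃ N, ∀ m, N ≤ m → u (m+1) = u m
  · left
    obtain ⟨N, hN⟩ := h
    refine ⟨N, fun m hm => ?_⟩
    induction m, hm using Nat.le_induction with
    | base => rfl
    | succ k hk ih => rw [hN k hk, ih]
  · right
    push Not at h
    have hmono : Monotone u := monotone_nat_of_le_succ (fun m => by
      rcases hu m with h | h <;> linarith)
    have key : ∀ k : ℕ, ∃ m, u 0 + k ≤ u m := by
      intro k
      induction k with
      | zero => exact ⟨0, by simp⟩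
      | succ k ih =>
        obtain ⟨m, hm⟩ := ih
        obtain ⟨p, hp, hne⟩ := h m
        refine ⟨p+1, ?_⟩
        have h1 := (hu p).resolve_left hne
        have h2 := hmono hp
        push_cast
        linarith
    intro x
    obtain ⟨k, hk⟩ := exists_nat_gt (x - u 0)
    obtain ⟨m, hm⟩ := key k
    exact ⟨m, by linarith⟩

lemma aux_one (a : ℕ → ℝ)
    (ha : ∀ m, a (m+1) = a m ∨ a (m+1) = a m - 2 ^ (m+1)) :
    ((∃ c : ℝ, (⋃ m, Ico (a m) (a m + 2^(m+1))) = Iio c) ∨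
      (∃ c : ℝ, (⋃ m, Ico (a m) (a m + 2^(m+1))) = Ici c) ∨
      (⋃ m, Ico (a m) (a m + 2^(m+1))) = univ) := by
  have hp : ∀ m : ℕ, (1:ℝ) ≤ 2^(m+1) := fun m => one_le_pow₀ (by norm_num)
  have hs : ∀ m : ℕ, (2:ℝ)^(m+1+1) = 2 * 2^(m+1) := fun m => by ring
  have hanti : Antitone a := antitone_nat_of_succ_le (fun m => by
    rcases ha m with h | h <;> linarith [hp m])
  have hmono : Monotone (fun m => a m + 2^(m+1)) := monotone_nat_of_le_succ (fun m => by
    have := hs m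
    rcases ha m with h | h <;> linarith [hp m])
  have A := aux_seq (fun m => - a m) (fun m => by
    rcases ha m with h | h
    · left; simp [h]
    · right; linarith [hp m])
  have B := aux_seq (fun m => a m + 2^(m+1)) (fun m => by
    have := hs m
    have := hp m
    rcases ha m with h | h
    · right; linarith
    · left; linarith)
  rcases A with ⟨N, hN⟩ | A <;> rcases B with ⟨M, hM⟩ | B
  · exfalso
    have h1 := hN (max N M) (le_max_left _ _)
    have h2 := hN (max N M + 1) (by omega)
    have h3 := hM (max N M) (le_max_right _ _)
    have h4 := hM (max N M + 1) (by omega)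
    have := hs (max N M)
    have := hp (max N M)
    linarith
  · right; left
    refine ⟨a N, ?_⟩
    ext x
    simp only [mem_iUnion, mem_Ico, mem_Ici]
    constructor
    · rintro ⟨m, h1, h2⟩
      rcases le_total N m with h | h
      · have := hN m h
        linarith
      · exact (hanti h).trans h1
    · intro hx
      obtain ⟨m, hm⟩ := B x
      refine ⟨max N m, (hanti (le_max_left _ _)).trans hx, hm.trans_le (hmono (le_max_right N m))⟩
  · left
    refine ⟨a M + 2^(M+1), ?_⟩
    ext x
    simp only [mem_iUnion, mem_Ico, mem_Iio]
    constructor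
    · rintro ⟨m, h1, h2⟩
      rcases le_total M m with h | h
      · have := hM m h
        linarith
      · exact h2.trans_le (hmono h)
    · intro hx
      obtain ⟨m, hm⟩ := A (-x)
      refine ⟨max M m, ?_, hx.trans_le (hmono (le_max_left M m))⟩
      have := hanti (le_max_right M m)
      linarith
  · right; right
    ext x
    simp only [mem_iUnion, mem_Ico, mem_univ, iff_true]
    obtain ⟨m, hm⟩ := A (-x)
    obtain ⟨k, hk⟩ := B x
    refine ⟨max m k, ?_, hk.trans_le (hmono (le_max_right m k))⟩
    have := hanti (le_max_left m k)
    linarith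

lemma aux_step {n : ℕ} (D : Set (Set (Fin n → ℝ))) (hD : IsDyadicGrid D) (k : ℤ)
    (a b : Fin n → ℝ) (ha : cubeOf a ((2:ℝ)^(k+1)) ∈ D) (hb : cubeOf b ((2:ℝ)^k) ∈ D)
    (hsub : cubeOf b ((2:ℝ)^k) ⊆ cubeOf a ((2:ℝ)^(k+1))) (i : Fin n) :
    a i = b i ∨ a i = b i - (2:ℝ)^k := by
  have hL : (0:ℝ) < 2^k := by positivity
  have h2L : (2:ℝ)^(k+1) = 2 * 2^k := by rw [zpow_add_one₀ (by norm_num)]; ring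
  have hbb : b ∈ cubeOf b ((2:ℝ)^k) := fun j => ⟨le_rfl, by linarith⟩
  have hba := hsub hbb
  obtain ⟨-, hU, hC⟩ := hD
  have hupper : b i + 2^k ≤ a i + 2^(k+1) := by
    refine le_of_forall_lt fun c hc => ?_
    have hm : Function.update b i (max (b i) c) ∈ cubeOf b ((2:ℝ)^k) := by
      intro j
      by_cases hj : j = i
      · subst hj
        simp [hL, hc]
      · simpa [hj] using hbb j
    have := (hsub hm i).2
    simp only [Function.update_self] at this
    exact (le_max_right _ _).trans_lt this
  by_contra hcon
  push Not at hcon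
  obtain ⟨h1, h2⟩ := hcon
  have hlt : a i < b i := lt_of_le_of_ne (hba i).1 h1
  have hlt2 : b i < a i + 2^k := by
    refine lt_of_le_of_ne (by linarith) ?_
    intro h; apply h2; linarith
  obtain ⟨C, -, hCD, hCs, hCu⟩ := hC (k+1) _ ha ⟨a, rfl⟩
  have hpQ : Function.update b i (a i) ∈ cubeOf a ((2:ℝ)^(k+1)) := by
    intro j
    by_cases hj : j = i
    · subst hj
      simp; positivity
    · simpa [hj] using hba j
  rw [hCu] at hpQ
  obtain ⟨Q', hQ', hpQ'⟩ := hpQ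
  have hs := hCs Q' hQ'
  rw [add_sub_cancel_right] at hs
  obtain ⟨c, hc⟩ := id hs
  have hcc : c ∈ cubeOf a ((2:ℝ)^(k+1)) := by
    rw [hCu]
    exact ⟨Q', hQ', by rw [hc]; exact fun j => ⟨le_rfl, by linarith⟩⟩
  have hpc := hpQ'
  rw [hc] at hpc
  have hbQ' : b ∈ Q' := by
    rw [hc]
    intro j
    by_cases hj : j = i
    · subst hj
      have h3 := (hpc j).1
      simp only [Function.update_self] at h3
      have h4 := (hcc j).1
      exact ⟨by linarith, by linarith⟩
    · simpa [hj] using hpc j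
  have heq := (hU k b).unique ⟨hCD hQ', hs, hbQ'⟩ ⟨hb, ⟨b, rfl⟩, hbb⟩
  rw [heq] at hpQ'
  have := (hpQ' i).1
  simp only [Function.update_self] at this
  linarith

/-- The top of a `D`-tower is a product `∏ k, F k` of `n` intervals, each of the form
`(-∞, a)`, `[a, ∞)` or `(-∞, ∞)`. -/
theorem towerTop_eq_prod_of_halfInfinite_intervals (n : ℕ) (D : Set (Set (Fin n → ℝ)))
    (hD : IsDyadicGrid D) (Γ : ℕ → Set (Fin n → ℝ)) (hΓ : IsTower D Γ) :
    ∃ F : Fin n → Set ℝ,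
      (∀ k, (∃ a : ℝ, F k = Set.Iio a) ∨ (∃ a : ℝ, F k = Set.Ici a) ∨ F k = Set.univ) ∧
      towerTop Γ = {x | ∀ k, x k ∈ F k} := by
  obtain ⟨hmem, hsub, hside⟩ := hΓ
  choose a ha using hside
  have hstep : ∀ i m, a (m+1) i = a m i ∨ a (m+1) i = a m i - 2^(m+1) := by
    intro i m
    have h1 := hmem m
    have h2 := hmem (m+1)
    have h3 := hsub m
    rw [ha m, ha (m+1)] at h3
    rw [ha m] at h1
    rw [ha (m+1)] at h2
    have := aux_step D hD ((m+1 : ℕ) : ℤ) (a (m+1)) (a m)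
      (by exact_mod_cast h2) (by exact_mod_cast h1) (by exact_mod_cast h3) i
    exact_mod_cast this
  refine ⟨fun i => ⋃ m, Ico (a m i) (a m i + 2^(m+1)),
    fun i => aux_one (fun m => a m i) (hstep i), ?_⟩
  have hp : ∀ m : ℕ, (1:ℝ) ≤ 2^(m+1) := fun m => one_le_pow₀ (by norm_num)
  have hs : ∀ m : ℕ, (2:ℝ)^(m+1+1) = 2 * 2^(m+1) := fun m => by ring
  ext x
  simp only [towerTop, mem_iUnion, mem_setOf_eq]
  constructor
  · rintro ⟨m, hm⟩ i
    rw [ha m] at hm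
    exact ⟨m, hm i⟩
  · intro h
    choose f hf using h
    refine ⟨Finset.univ.sup f, ?_⟩
    rw [ha]
    intro i
    have hle : f i ≤ Finset.univ.sup f := Finset.le_sup (Finset.mem_univ i)
    have hanti : Antitone (fun m => a m i) := antitone_nat_of_succ_le (fun m => by
      rcases hstep i m with h | h <;> linarith [hp m])
    have hmono : Monotone (fun m => a m i + 2^(m+1)) := monotone_nat_of_le_succ (fun m => by
      have := hs m
      rcases hstep i m with h | h <;> linarith [hp m])
    exact ⟨(hanti hle).trans (hf i).1, (hf i).2.trans_le (hmono hle)⟩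
end

section
/- Let D be a dyadic grid in ℝⁿ. Then the collection of distinct tops of D-towers is a finite set of cardinality T with 1 ≤ T ≤ 2ⁿ, and ℝⁿ is the disjoint union of these T tops. -/
open Set

/-- Choice of the cube of each level containing a point. -/
theorem exists_cubes {n : ℕ} {D : Set (Set (Fin n → ℝ))} (hD : IsDyadicGrid D) :
    ∃ q : ℕ → (Fin n → ℝ) → Set (Fin n → ℝ),
      (∀ m x, q m x ∈ D) ∧ (∀ m x, HasSideLength (q m x) ((2:ℝ) ^ (m + 1))) ∧
      (∀ m x, x ∈ q m x) ∧ (∀ m x, q m x ⊆ q (m + 1) x) ∧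
      (∀ m x Q, Q ∈ D → HasSideLength Q ((2:ℝ) ^ (m + 1)) → x ∈ Q → Q = q m x) := by
  obtain ⟨-, h2, h3⟩ := hD
  choose Q hQ hu using h2
  have e : ∀ m : ℕ, (2:ℝ) ^ ((m : ℤ) + 1) = (2:ℝ) ^ (m + 1) := fun m => by
    exact_mod_cast zpow_natCast (2:ℝ) (m + 1)
  refine ⟨fun m x => Q ((m : ℤ) + 1) x, fun m x => (hQ _ _).1, fun m x => ?_,
    fun m x => (hQ _ _).2.2, fun m x => ?_, fun m x P hP hs hx => ?_⟩
  · rw [← e]; exact (hQ _ _).2.1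
  · obtain ⟨C, -, hCD, hCs, hCu⟩ := h3 _ _ (hQ (((m + 1 : ℕ) : ℤ) + 1) x).1
      (hQ (((m + 1 : ℕ) : ℤ) + 1) x).2.1
    have hx := (hQ (((m + 1 : ℕ) : ℤ) + 1) x).2.2
    rw [hCu] at hx
    obtain ⟨P, hPC, hxP⟩ := hx
    have hs := hCs P hPC
    have e2 : (((m + 1 : ℕ) : ℤ) + 1 - 1) = (m : ℤ) + 1 := by push_cast; ring
    rw [e2] at hs
    have := hu _ _ P ⟨hCD hPC, hs, hxP⟩
    intro y hy
    show y ∈ Q (((m + 1 : ℕ) : ℤ) + 1) x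
    rw [hCu]
    refine ⟨P, hPC, ?_⟩
    rw [this]
    exact hy
  · exact hu _ _ P ⟨hP, by rw [e]; exact hs, hx⟩

theorem tops_finite_card_le_and_partition (n : ℕ) (D : Set (Set (Fin n → ℝ)))
    (hD : IsDyadicGrid D) :
    ∃ Tops : Finset (Set (Fin n → ℝ)),
      (∀ S : Set (Fin n → ℝ), S ∈ Tops ↔ ∃ Γ, IsTower D Γ ∧ towerTop Γ = S) ∧
      1 ≤ Tops.card ∧ Tops.card ≤ 2 ^ n ∧
      (∀ x : Fin n → ℝ, ∃! S, S ∈ Tops ∧ x ∈ S) := by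
  obtain ⟨q, qD, qs, qx, qm, qu⟩ := exists_cubes hD
  have mono : ∀ Γ, IsTower D Γ → Monotone Γ := fun Γ h => monotone_nat_of_le_succ h.2.1
  have qT : ∀ x, IsTower D (fun m => q m x) := fun x =>
    ⟨fun m => qD m x, fun m => qm m x, fun m => qs m x⟩
  have key : ∀ Γ, IsTower D Γ → ∀ x ∈ towerTop Γ, towerTop Γ = towerTop (fun m => q m x) := by
    intro Γ h x hx
    obtain ⟨m₀, hm₀⟩ := mem_iUnion.1 hx
    have he : ∀ m, m₀ ≤ m → Γ m = q m x := fun m hm =>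
      qu m x _ (h.1 m) (h.2.2 m) (mono Γ h hm hm₀)
    ext y
    simp only [towerTop, mem_iUnion]
    constructor
    · rintro ⟨m, hy⟩
      refine ⟨max m m₀, ?_⟩
      rw [← he _ (le_max_right _ _)]
      exact mono Γ h (le_max_left _ _) hy
    · rintro ⟨m, hy⟩
      refine ⟨max m m₀, ?_⟩
      rw [he _ (le_max_right _ _)]
      exact mono _ (qT x) (le_max_left m m₀) hy
  have bound : ∀ G : Finset (Set (Fin n → ℝ)),
      (∀ S ∈ G, ∃ x, towerTop (fun m => q m x) = S) → G.card ≤ 2 ^ n := by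
    intro G hG
    choose! p hp using hG
    obtain ⟨R, hR⟩ : ∃ R : ℝ, ∀ S ∈ G, ‖p S‖ ≤ R := by
      obtain ⟨R, hR⟩ := (G.image fun S => ‖p S‖).bddAbove
      exact ⟨R, fun S hS => hR (by
        simp only [Finset.coe_image]; exact ⟨S, hS, rfl⟩)⟩
    obtain ⟨m, hm⟩ := pow_unbounded_of_one_lt (2 * R) (one_lt_two : (1:ℝ) < 2)
    have hm' : 2 * R < 2 ^ (m + 1) := by
      have : (0:ℝ) < 2 ^ m := by positivity
      rw [pow_succ]; linarith
    have hc : ∀ S ∈ G, ∃ e : Fin n → Bool, (fun i => if e i then R else -R) ∈ q m (p S) := by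
      intro S hS
      obtain ⟨a, ha⟩ := qs m (p S)
      have hx := qx m (p S)
      rw [ha] at hx ⊢
      refine ⟨fun i => decide (-R < a i), fun i => ?_⟩
      have h1 := hx i
      have h2 := abs_le.1 ((norm_le_pi_norm (p S) i).trans (hR S hS))
      simp only [mem_Ico, decide_eq_true_eq] at h1 ⊢
      split_ifs with h <;> constructor <;> linarith
    choose! e he using hc
    have : G.card ≤ (Finset.univ : Finset (Fin n → Bool)).card := by
      refine Finset.card_le_card_of_injOn e (fun _ _ => Finset.mem_coe.2 (Finset.mem_univ _)) ?_
      intro S hS S' hS' hee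
      have h1 := he S hS
      have h2 := he S' hS'
      rw [← hee] at h2
      have h3 := key _ (qT (p S)) _ (mem_iUnion.2 ⟨m, h1⟩)
      have h4 := key _ (qT (p S')) _ (mem_iUnion.2 ⟨m, h2⟩)
      rw [← hp S hS, ← hp S' hS', h3, h4]
    simpa using this
  have hfin : (range fun x => towerTop (fun m => q m x)).Finite := by
    by_contra hinf
    obtain ⟨G, hG, hc⟩ := Set.Infinite.exists_subset_card_eq hinf (2 ^ n + 1)
    have := bound G (fun S hS => hG hS)
    omega
  have hmem : ∀ S, S ∈ hfin.toFinset ↔ ∃ x, towerTop (fun m => q m x) = S := by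
    intro S; simp
  have hself : ∀ x, x ∈ towerTop (fun m => q m x) := fun x => mem_iUnion.2 ⟨0, qx 0 x⟩
  refine ⟨hfin.toFinset, fun S => ?_, ?_, bound _ fun S hS => (hmem S).1 hS, fun x => ?_⟩
  · rw [hmem]
    constructor
    · rintro ⟨x, rfl⟩
      exact ⟨_, qT x, rfl⟩
    · rintro ⟨Γ, h, rfl⟩
      obtain ⟨a, ha⟩ := h.2.2 0
      have : a ∈ Γ 0 := by
        rw [ha]; intro i; simp
      exact ⟨a, (key Γ h a (mem_iUnion.2 ⟨0, this⟩)).symm⟩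
  · exact Finset.card_pos.2 ⟨_, (hmem _).2 ⟨0, rfl⟩⟩
  · refine ⟨_, ⟨(hmem _).2 ⟨x, rfl⟩, hself x⟩, ?_⟩
    rintro S ⟨hS, hx⟩
    obtain ⟨y, rfl⟩ := (hmem _).1 hS
    exact key _ (qT y) x hx
end

section
/- Let D be a dyadic grid in ℝⁿ, and for each D-tower Γ with top Γ = ∏_{k=1}^n F_k (each F_k an interval of the form (-∞, a_k), [a_k, ∞), or (-∞, ∞)), say top Γ is associated with a sign pattern θ = (θ_1, …, θ_n) ∈ {-∞, +∞}ⁿ if for each k, θ_k is an (infinite) endpoint of F_k. Then any two tops of D-towers associated with the same sign pattern θ coincide. -/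
open Set

/-- `S` (a product of `n` intervals, each of the form `(-∞,a)`, `[a,∞)` or `(-∞,∞)`) is
associated with the sign pattern `θ : Fin n → Bool` (`true` standing for `+∞`, `false` for
`-∞`) if for each coordinate `k`, `θ k` is an infinite endpoint of the `k`-th factor. -/
def TopAssociatedWith {n : ℕ} (S : Set (Fin n → ℝ)) (θ : Fin n → Bool) : Prop :=
  ∃ F : Fin n → Set ℝ,
    S = {x | ∀ k, x k ∈ F k} ∧
    ∀ k, if θ k then ((∃ a : ℝ, F k = Set.Ici a) ∨ F k = Set.univ)
      else ((∃ a : ℝ, F k = Set.Iio a) ∨ F k = Set.univ)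

/-- Any two tops of `D`-towers associated with the same sign pattern `θ ∈ {-∞, +∞}ⁿ`
coincide. -/
theorem towerTop_eq_of_same_sign_pattern (n : ℕ) (D : Set (Set (Fin n → ℝ)))
    (hD : IsDyadicGrid D) (Γ₁ Γ₂ : ℕ → Set (Fin n → ℝ))
    (h₁ : IsTower D Γ₁) (h₂ : IsTower D Γ₂) (θ : Fin n → Bool)
    (hθ₁ : TopAssociatedWith (towerTop Γ₁) θ) (hθ₂ : TopAssociatedWith (towerTop Γ₂) θ) :
    towerTop Γ₁ = towerTop Γ₂ := by
  obtain ⟨F, hF, hF'⟩ := hθ₁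
  obtain ⟨G, hG, hG'⟩ := hθ₂
  have hx : ∀ k, ∃ t : ℝ, t ∈ F k ∧ t ∈ G k := by
    intro k
    have h1 := hF' k
    have h2 := hG' k
    by_cases hk : θ k = true
    · rw [if_pos hk] at h1 h2
      rcases h1 with ⟨a, ha⟩ | ha <;> rcases h2 with ⟨b, hb⟩ | hb <;> rw [ha, hb]
      · exact ⟨max a b, le_max_left a b, le_max_right a b⟩
      · exact ⟨a, le_refl a, trivial⟩
      · exact ⟨b, trivial, le_refl b⟩
      · exact ⟨0, trivial, trivial⟩
    · rw [if_neg hk] at h1 h2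
      rcases h1 with ⟨a, ha⟩ | ha <;> rcases h2 with ⟨b, hb⟩ | hb <;> rw [ha, hb]
      · refine ⟨min a b - 1, ?_, ?_⟩
        · have := min_le_left a b
          simp only [Set.mem_Iio]; linarith
        · have := min_le_right a b
          simp only [Set.mem_Iio]; linarith
      · exact ⟨a - 1, by simp, trivial⟩
      · exact ⟨b - 1, trivial, by simp⟩
      · exact ⟨0, trivial, trivial⟩
  choose x hx1 hx2 using hx
  have m1 : x ∈ towerTop Γ₁ := by rw [hF]; exact hx1
  have m2 : x ∈ towerTop Γ₂ := by rw [hG]; exact hx2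
  obtain ⟨p, hp⟩ := Set.mem_iUnion.1 m1
  obtain ⟨q, hq⟩ := Set.mem_iUnion.1 m2
  have mono1 : Monotone Γ₁ := monotone_nat_of_le_succ h₁.2.1
  have mono2 : Monotone Γ₂ := monotone_nat_of_le_succ h₂.2.1
  have key : ∀ m, p ≤ m → q ≤ m → Γ₁ m = Γ₂ m := by
    intro m hpm hqm
    have e : (2:ℝ) ^ ((m + 1 : ℕ) : ℤ) = (2:ℝ) ^ (m + 1) := zpow_natCast _ _
    refine (hD.2.1 ((m + 1 : ℕ) : ℤ) x).unique ?_ ?_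
    · rw [e]; exact ⟨h₁.1 m, h₁.2.2 m, mono1 hpm hp⟩
    · rw [e]; exact ⟨h₂.1 m, h₂.2.2 m, mono2 hqm hq⟩
  apply Set.Subset.antisymm
  · refine Set.iUnion_subset fun m => ?_
    have h := key (m + p + q) (by omega) (by omega)
    exact (mono1 (by omega : m ≤ m + p + q)).trans (h.le.trans (Set.subset_iUnion Γ₂ _))
  · refine Set.iUnion_subset fun m => ?_
    have h := key (m + p + q) (by omega) (by omega)
    exact (mono2 (by omega : m ≤ m + p + q)).trans (h.ge.trans (Set.subset_iUnion Γ₁ _))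
end

section
/- Let D be a dyadic grid on the real line ℝ. Then D is a translate of the standard dyadic grid D₀ (i.e. D = D₀ + a = {I + a : I ∈ D₀} for some a ∈ ℝ) if and only if D has exactly two distinct tops of D-towers. Moreover, if the two tops are (-∞, a) and [a, ∞), then D = D₀ + a. -/
open Set

/-- `I` is a half-open interval of length `ℓ`. -/
def HasLen (I : Set ℝ) (ℓ : ℝ) : Prop :=
  ∃ a : ℝ, I = Set.Ico a (a + ℓ)

/-- A dyadic grid on the real line: for each `k : ℤ` the intervals of length `2^k` partition
`ℝ`, and every interval of length `2^k` is the union of `2` intervals of length `2^(k-1)`. -/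
def IsDyadicGridR (D : Set (Set ℝ)) : Prop :=
  (∀ I ∈ D, ∃ k : ℤ, HasLen I ((2:ℝ) ^ k)) ∧
  (∀ k : ℤ, ∀ x : ℝ, ∃! I, I ∈ D ∧ HasLen I ((2:ℝ) ^ k) ∧ x ∈ I) ∧
  (∀ k : ℤ, ∀ I ∈ D, HasLen I ((2:ℝ) ^ k) →
    ∃ C : Finset (Set ℝ), C.card = 2 ∧ ↑C ⊆ D ∧
      (∀ I' ∈ C, HasLen I' ((2:ℝ) ^ (k - 1))) ∧ I = ⋃₀ ↑C)

/-- A `D`-tower on the line: nested intervals of `D` of lengths `2^m`, `m = 1, 2, 3, …`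
(indexed here by `m : ℕ` with `Γ m` of length `2^(m+1)`). -/
def IsTowerR (D : Set (Set ℝ)) (Γ : ℕ → Set ℝ) : Prop :=
  (∀ m, Γ m ∈ D) ∧ (∀ m, Γ m ⊆ Γ (m + 1)) ∧
  (∀ m : ℕ, HasLen (Γ m) ((2:ℝ) ^ (m + 1)))

/-- The top of a tower. -/
def towerTopR (Γ : ℕ → Set ℝ) : Set ℝ := ⋃ m, Γ m

/-- The standard dyadic grid on `ℝ`: all intervals `[m 2^k, (m+1) 2^k)`, `k, m : ℤ`. -/
def stdGridR : Set (Set ℝ) :=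
  {I | ∃ k m : ℤ, I = Set.Ico ((m : ℝ) * 2 ^ k) (((m : ℝ) + 1) * 2 ^ k)}

def PP (D : Set (Set ℝ)) (k : ℤ) (c : ℝ) : Prop := Set.Ico c (c + (2:ℝ) ^ k) ∈ D

lemma two_pos' (k : ℤ) : (0:ℝ) < (2:ℝ) ^ k := by positivity

lemma ico_left {c d p q : ℝ} (hc : c < p) (hd : d < q) (h : Set.Ico c p = Set.Ico d q) :
    c = d := by
  have h1 : c ∈ Set.Ico d q := h ▸ Set.left_mem_Ico.2 hc
  have h2 : d ∈ Set.Ico c p := h ▸ Set.left_mem_Ico.2 hd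
  exact le_antisymm h2.1 h1.1

lemma PP_uniq {D} (hD : IsDyadicGridR D) {k : ℤ} {c d x : ℝ} (hc : PP D k c) (hd : PP D k d)
    (h1 : c ≤ x) (h2 : x < c + 2 ^ k) (h3 : d ≤ x) (h4 : x < d + 2 ^ k) : c = d := by
  have heq := (hD.2.1 k x).unique ⟨hc, ⟨c, rfl⟩, ⟨h1, h2⟩⟩ ⟨hd, ⟨d, rfl⟩, ⟨h3, h4⟩⟩
  have := two_pos' k
  exact ico_left (lt_of_le_of_lt h1 h2) (lt_of_le_of_lt h3 h4) heq

lemma PP_ex {D} (hD : IsDyadicGridR D) (k : ℤ) (x : ℝ) :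
    ∃ c, PP D k c ∧ c ≤ x ∧ x < c + 2 ^ k := by
  obtain ⟨I, ⟨h1, ⟨c, rfl⟩, h3⟩, -⟩ := hD.2.1 k x
  exact ⟨c, h1, h3.1, h3.2⟩

lemma PP_right {D} (hD : IsDyadicGridR D) {k : ℤ} {c : ℝ} (hc : PP D k c) :
    PP D k (c + 2 ^ k) := by
  have hp := two_pos' k
  obtain ⟨e, he, h1, h2⟩ := PP_ex hD k (c + 2 ^ k)
  rcases h1.eq_or_lt with h | h
  · rwa [h] at he
  · have := PP_uniq hD (x := e) hc he (by linarith) h le_rfl (by linarith)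
    linarith

lemma PP_left {D} (hD : IsDyadicGridR D) {k : ℤ} {c : ℝ} (hc : PP D k c) :
    PP D k (c - 2 ^ k) := by
  have hp := two_pos' k
  obtain ⟨e, he, h1, h2⟩ := PP_ex hD k (c - 2 ^ k)
  have := PP_uniq hD (x := c) hc (PP_right hD he) le_rfl (by linarith) (by linarith) (by linarith)
  have h : c - 2 ^ k = e := by linarith
  rwa [h]

lemma PP_int {D} (hD : IsDyadicGridR D) {k : ℤ} {c : ℝ} (hc : PP D k c) (m : ℤ) :
    PP D k (c + m * 2 ^ k) := by
  induction m using Int.induction_on with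
  | zero => simpa using hc
  | succ i ih =>
    have := PP_right hD ih
    convert this using 1
    push_cast; ring
  | pred i ih =>
    have := PP_left hD ih
    convert this using 1
    push_cast; ring

lemma PP_int' {D} (hD : IsDyadicGridR D) {k : ℤ} {c d : ℝ} (hc : PP D k c) (hd : PP D k d) :
    ∃ m : ℤ, d = c + m * 2 ^ k := by
  have hp := two_pos' k
  refine ⟨⌊(d - c) / 2 ^ k⌋, ?_⟩
  have h1 := Int.floor_le ((d - c) / 2 ^ k)
  have h2 := Int.lt_floor_add_one ((d - c) / 2 ^ k)
  rw [le_div_iff₀ hp] at h1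
  rw [div_lt_iff₀ hp] at h2
  exact PP_uniq hD (x := d) hd (PP_int hD hc _) le_rfl (by linarith) (by linarith) (by linarith)

lemma PP_down {D} (hD : IsDyadicGridR D) {k : ℤ} {d x : ℝ} (hd : PP D (k + 1) d)
    (h1 : d ≤ x) (h2 : x < d + 2 ^ (k + 1)) :
    ∃ c, PP D k c ∧ c ≤ x ∧ x < c + 2 ^ k ∧ d ≤ c ∧ c + 2 ^ k ≤ d + 2 ^ (k + 1) := by
  obtain ⟨C, -, hC, hl, hU⟩ := hD.2.2 (k + 1) _ hd ⟨d, rfl⟩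
  have hx : x ∈ ⋃₀ (C : Set (Set ℝ)) := hU ▸ ⟨h1, h2⟩
  obtain ⟨J, hJ, hxJ⟩ := hx
  obtain ⟨c, hc⟩ := hl J hJ
  rw [add_sub_cancel_right] at hc
  have hsub : Set.Ico c (c + 2 ^ k) ⊆ Set.Ico d (d + 2 ^ (k + 1)) := by
    rw [hU, ← hc]; exact Set.subset_sUnion_of_mem hJ
  have hp := two_pos' k
  rw [Set.Ico_subset_Ico_iff (by linarith)] at hsub
  have hJD := hC hJ
  subst hc
  exact ⟨c, hJD, hxJ.1, hxJ.2, hsub.1, hsub.2⟩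

lemma PP_same {D} (hD : IsDyadicGridR D) {k : ℤ} {d : ℝ} (hd : PP D (k + 1) d) : PP D k d := by
  obtain ⟨c, hc, h1, h2, h3, h4⟩ := PP_down hD (x := d) hd le_rfl
    (by have := two_pos' (k+1); linarith)
  rwa [le_antisymm h3 h1]

lemma PP_nest {D} (hD : IsDyadicGridR D) {k : ℤ} {c d x : ℝ} (hc : PP D k c)
    (hd : PP D (k + 1) d) (h1 : c ≤ x) (h2 : x < c + 2 ^ k) (h3 : d ≤ x)
    (h4 : x < d + 2 ^ (k + 1)) : d ≤ c ∧ c + 2 ^ k ≤ d + 2 ^ (k + 1) := by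
  obtain ⟨c', hc', h5, h6, h7⟩ := PP_down hD hd h3 h4
  rwa [PP_uniq hD hc hc' h1 h2 h5 h6]

lemma PP_down_nat {D} (hD : IsDyadicGridR D) {k : ℤ} {d : ℝ} (n : ℕ) (hd : PP D (k + n) d) :
    PP D k d := by
  induction n with
  | zero => simpa using hd
  | succ n ih =>
    apply ih
    apply PP_same hD
    convert hd using 1
    push_cast; ring

/-- left endpoint -/
noncomputable def LEnd {D} (hD : IsDyadicGridR D) (k : ℤ) (x : ℝ) : ℝ := (PP_ex hD k x).choose

lemma LEnd_spec {D} (hD : IsDyadicGridR D) (k : ℤ) (x : ℝ) :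
    PP D k (LEnd hD k x) ∧ LEnd hD k x ≤ x ∧ x < LEnd hD k x + 2 ^ k := (PP_ex hD k x).choose_spec

lemma LEnd_eq {D} (hD : IsDyadicGridR D) {k : ℤ} {c x : ℝ} (hc : PP D k c)
    (h1 : c ≤ x) (h2 : x < c + 2 ^ k) : LEnd hD k x = c := by
  obtain ⟨h3, h4, h5⟩ := LEnd_spec hD k x
  exact PP_uniq hD h3 hc h4 h5 h1 h2

noncomputable def GG {D} (hD : IsDyadicGridR D) (x : ℝ) (m : ℕ) : Set ℝ :=
  Set.Ico (LEnd hD (m + 1 : ℕ) x) (LEnd hD (m + 1 : ℕ) x + 2 ^ (m + 1))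

lemma GG_tower {D} (hD : IsDyadicGridR D) (x : ℝ) : IsTowerR D (GG hD x) := by
  refine ⟨fun m => ?_, fun m => ?_, fun m => ⟨_, rfl⟩⟩
  · have := (LEnd_spec hD (m + 1 : ℕ) x).1
    unfold PP at this
    rwa [zpow_natCast] at this
  · obtain ⟨a1, a2, a3⟩ := LEnd_spec hD (m + 1 : ℕ) x
    obtain ⟨b1, b2, b3⟩ := LEnd_spec hD (m + 1 + 1 : ℕ) x
    have e : ((m + 1 + 1 : ℕ) : ℤ) = ((m + 1 : ℕ) : ℤ) + 1 := by push_cast; ring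
    have := PP_nest hD a1 (e ▸ b1) a2 a3 (e ▸ b2) (e ▸ b3)
    rw [← e, zpow_natCast, zpow_natCast] at this
    exact Set.Ico_subset_Ico this.1 this.2

lemma mem_GG {D} (hD : IsDyadicGridR D) (x : ℝ) (m : ℕ) : x ∈ GG hD x m := by
  obtain ⟨a1, a2, a3⟩ := LEnd_spec hD (m + 1 : ℕ) x
  rw [zpow_natCast] at a3
  exact ⟨a2, a3⟩

lemma tower_mono {D Γ} (h : IsTowerR D Γ) : Monotone Γ := monotone_nat_of_le_succ h.2.1

lemma tower_eq {D} (hD : IsDyadicGridR D) {Γ} (h : IsTowerR D Γ) {x : ℝ} {m : ℕ}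
    (hx : x ∈ Γ m) : Γ m = GG hD x m := by
  have key : ∀ {Δ : ℕ → Set ℝ}, IsTowerR D Δ → HasLen (Δ m) ((2:ℝ) ^ ((m + 1 : ℕ) : ℤ)) := by
    intro Δ h
    rw [zpow_natCast]; exact h.2.2 m
  exact (hD.2.1 (m + 1 : ℕ) x).unique ⟨h.1 m, key h, hx⟩
    ⟨(GG_tower hD x).1 m, key (GG_tower hD x), mem_GG hD x m⟩

lemma top_eq {D} (hD : IsDyadicGridR D) {Γ} (h : IsTowerR D Γ) {x : ℝ}
    (hx : x ∈ towerTopR Γ) : towerTopR Γ = towerTopR (GG hD x) := by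
  obtain ⟨m, hm⟩ := Set.mem_iUnion.1 hx
  have hE : ∀ n ≥ m, Γ n = GG hD x n := fun n hn => tower_eq hD h (tower_mono h hn hm)
  apply Set.Subset.antisymm
  · refine Set.iUnion_subset fun n => ?_
    refine (tower_mono h (le_max_left n m)).trans ?_
    rw [hE _ (le_max_right n m)]
    exact Set.subset_iUnion (GG hD x) _
  · refine Set.iUnion_subset fun n => ?_
    refine (tower_mono (GG_tower hD x) (le_max_left n m)).trans ?_
    rw [← hE _ (le_max_right n m)]
    exact Set.subset_iUnion Γ _

lemma mem_top {D} (hD : IsDyadicGridR D) (x : ℝ) : x ∈ towerTopR (GG hD x) :=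
  Set.mem_iUnion.2 ⟨0, mem_GG hD x 0⟩

lemma top_eq' {D} (hD : IsDyadicGridR D) {x y : ℝ} (h : y ∈ towerTopR (GG hD x)) :
    towerTopR (GG hD x) = towerTopR (GG hD y) := top_eq hD (GG_tower hD x) h

lemma tops_eq {D} (hD : IsDyadicGridR D) :
    {S : Set ℝ | ∃ Γ, IsTowerR D Γ ∧ towerTopR Γ = S} =
      Set.range (fun x => towerTopR (GG hD x)) := by
  ext S
  constructor
  · rintro ⟨Γ, h, rfl⟩
    obtain ⟨c, hc⟩ := h.2.2 0
    have : c ∈ Γ 0 := by rw [hc]; simp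
    exact ⟨c, (top_eq hD h (Set.mem_iUnion.2 ⟨0, this⟩)).symm⟩
  · rintro ⟨x, rfl⟩
    exact ⟨_, GG_tower hD x, rfl⟩

lemma eq_of_PP {D} (hD : IsDyadicGridR D) {a : ℝ} (h : ∀ k, PP D k a) :
    D = (fun I => (fun x => x + a) '' I) '' stdGridR := by
  have key : ∀ k m : ℤ, (fun x => x + a) '' Set.Ico ((m : ℝ) * 2 ^ k) (((m : ℝ) + 1) * 2 ^ k)
      = Set.Ico (a + m * 2 ^ k) (a + m * 2 ^ k + 2 ^ k) := by
    intro k m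
    rw [Set.image_add_const_Ico]
    congr 1 <;> ring
  ext I
  constructor
  · intro hI
    obtain ⟨k, d, rfl⟩ := hD.1 I hI
    obtain ⟨m, rfl⟩ := PP_int' hD (h k) hI
    exact ⟨_, ⟨k, m, rfl⟩, key k m⟩
  · rintro ⟨_, ⟨k, m, rfl⟩, rfl⟩
    simp only [key]
    exact PP_int hD (h k) m

lemma PP_of_eq {D} {a : ℝ} (h : D = (fun I => (fun x => x + a) '' I) '' stdGridR) (k : ℤ) :
    PP D k a := by
  unfold PP
  rw [h]
  refine ⟨_, ⟨k, 0, rfl⟩, ?_⟩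
  simp [Set.image_add_const_Ico, add_comm]

lemma PP_of_top {D} (hD : IsDyadicGridR D) {a : ℝ} (h : towerTopR (GG hD a) = Set.Ici a) (k : ℤ) :
    PP D k a := by
  have h1 : ∀ m : ℕ, PP D (m + 1 : ℕ) a := by
    intro m
    obtain ⟨a1, a2, a3⟩ := LEnd_spec hD (m + 1 : ℕ) a
    have : LEnd hD (m + 1 : ℕ) a ∈ towerTopR (GG hD a) :=
      Set.mem_iUnion.2 ⟨m, by simp [GG]⟩
    rw [h] at this
    rwa [le_antisymm a2 this] at a1
  have h2 := h1 (k.toNat + k.natAbs)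
  apply PP_down_nat hD (((k.toNat + k.natAbs + 1 : ℕ) : ℤ) - k).toNat
  convert h2 using 1
  omega

lemma big_pow (x : ℝ) : ∃ m : ℕ, x < (2:ℝ) ^ (m + 1) := by
  obtain ⟨n, hn⟩ := pow_unbounded_of_one_lt x (one_lt_two : (1:ℝ) < 2)
  exact ⟨n, hn.trans (pow_lt_pow_right₀ one_lt_two (Nat.lt_succ_self n))⟩

lemma top_Ici {D} (hD : IsDyadicGridR D) {a : ℝ} (h : ∀ k, PP D k a) :
    towerTopR (GG hD a) = Set.Ici a := by
  have hL : ∀ k, LEnd hD k a = a := fun k =>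
    LEnd_eq hD (h k) le_rfl (by have := two_pos' k; linarith)
  ext y
  simp only [towerTopR, Set.mem_iUnion, GG, hL, Set.mem_Ico, Set.mem_Ici]
  constructor
  · rintro ⟨_, h, _⟩; exact h
  · intro hy
    obtain ⟨m, hm⟩ := big_pow (y - a)
    exact ⟨m, hy, by linarith⟩

lemma top_Iio {D} (hD : IsDyadicGridR D) {a x : ℝ} (h : ∀ k, PP D k a) (hx : x < a) :
    towerTopR (GG hD x) = Set.Iio a := by
  ext y
  constructor
  · intro hy
    by_contra hya
    have hya : a ≤ y := not_lt.1 hya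
    have h1 := top_eq' hD hy
    have h2 : y ∈ towerTopR (GG hD a) := by rw [top_Ici hD h]; exact hya
    have h3 := mem_top hD x
    rw [h1, ← top_eq' hD h2, top_Ici hD h] at h3
    exact absurd hx (not_lt.2 h3)
  · intro hy
    have hy : y < a := hy
    obtain ⟨m, hm⟩ := big_pow (a - min x y)
    have hx' : min x y ≤ x := min_le_left _ _
    have hy' : min x y ≤ y := min_le_right _ _
    have hP := PP_left hD (h (m + 1 : ℕ))
    rw [zpow_natCast] at hP
    have hL := LEnd_eq hD (x := x) hP (by linarith) (by rw [zpow_natCast]; linarith)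
    refine Set.mem_iUnion.2 ⟨m, ?_⟩
    simp only [GG, hL]
    exact ⟨by linarith, by linarith⟩

lemma top_conn {D} (hD : IsDyadicGridR D) {x y z : ℝ} (hz : z ∈ towerTopR (GG hD y))
    (h1 : z ≤ x) (h2 : x ≤ y) : x ∈ towerTopR (GG hD y) := by
  obtain ⟨m, hm⟩ := Set.mem_iUnion.1 hz
  exact Set.mem_iUnion.2 ⟨m, hm.1.trans h1, h2.trans_lt (mem_GG hD y m).2⟩

lemma exists_top {D} (hD : IsDyadicGridR D) {x y : ℝ} (hxy : x < y)
    (hn : x ∉ towerTopR (GG hD y)) : ∃ a, towerTopR (GG hD a) = Set.Ici a := by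
  have hlow : ∀ m : ℕ, x < LEnd hD (m + 1 : ℕ) y := by
    intro m
    by_contra hc
    apply hn
    exact top_conn hD (z := LEnd hD (m + 1 : ℕ) y) (Set.mem_iUnion.2 ⟨m, by simp [GG]⟩)
      (not_lt.1 hc) hxy.le
  obtain ⟨m, hm⟩ := big_pow (y - x)
  have hconst : ∀ n : ℕ, LEnd hD (m + n + 1 : ℕ) y = LEnd hD (m + 1 : ℕ) y := by
    intro n
    induction n with
    | zero => rfl
    | succ n ih =>
      rw [← ih]
      obtain ⟨a1, a2, a3⟩ := LEnd_spec hD (m + n + 1 : ℕ) y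
      obtain ⟨b1, b2, b3⟩ := LEnd_spec hD (m + (n + 1) + 1 : ℕ) y
      have l1 := hlow (m + (n + 1))
      have hpw : (2:ℝ) ^ (m + 1) ≤ 2 ^ (m + n + 1) :=
        pow_le_pow_right₀ one_le_two (by omega)
      have e : ((m + (n + 1) + 1 : ℕ) : ℤ) = ((m + n + 1 : ℕ) : ℤ) + 1 := by push_cast; ring
      symm
      exact LEnd_eq hD (PP_same hD (e ▸ b1)) b2 (by rw [zpow_natCast]; linarith)
  refine ⟨LEnd hD (m + 1 : ℕ) y, ?_⟩
  have hmem : LEnd hD (m + 1 : ℕ) y ∈ towerTopR (GG hD y) := Set.mem_iUnion.2 ⟨m, by simp [GG]⟩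
  rw [← top_eq' hD hmem]
  ext z
  constructor
  · intro hz
    obtain ⟨n, hz⟩ := Set.mem_iUnion.1 hz
    have := tower_mono (GG_tower hD y) (Nat.le_add_left n m) hz
    have := this.1
    rwa [hconst] at this
  · intro hz
    have hz : _ ≤ z := hz
    obtain ⟨n, hn⟩ := big_pow (z - LEnd hD (m + 1 : ℕ) y)
    have hpw : (2:ℝ) ^ (n + 1) ≤ 2 ^ (m + n + 1) := pow_le_pow_right₀ one_le_two (by omega)
    refine Set.mem_iUnion.2 ⟨m + n, ?_⟩
    simp only [GG, hconst]
    exact ⟨hz, by linarith⟩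


/-- A dyadic grid `D` on `ℝ` is a translate `D₀ + a` of the standard grid if and only if it has
exactly two distinct tops of `D`-towers; moreover if the tops are `(-∞, a)` and `[a, ∞)`, then
`D = D₀ + a`. -/
theorem translate_of_stdGrid_iff_two_tops (D : Set (Set ℝ)) (hD : IsDyadicGridR D) :
    ((∃ a : ℝ, D = (fun I => (fun x => x + a) '' I) '' stdGridR) ↔
      {S : Set ℝ | ∃ Γ, IsTowerR D Γ ∧ towerTopR Γ = S}.ncard = 2) ∧
    (∀ a : ℝ,
      (∃ Γ, IsTowerR D Γ ∧ towerTopR Γ = Set.Iio a) →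
      (∃ Γ, IsTowerR D Γ ∧ towerTopR Γ = Set.Ici a) →
      D = (fun I => (fun x => x + a) '' I) '' stdGridR) := by
  refine ⟨⟨?_, ?_⟩, ?_⟩
  · rintro ⟨a, ha⟩
    have h := PP_of_eq ha
    have : Set.range (fun x => towerTopR (GG hD x)) = {Set.Iio a, Set.Ici a} := by
      ext S
      constructor
      · rintro ⟨x, rfl⟩
        rcases lt_or_ge x a with hx | hx
        · left; exact top_Iio hD h hx
        · right
          have h2 : x ∈ towerTopR (GG hD a) := by rw [top_Ici hD h]; exact hx
          exact (top_eq' hD h2).symm.trans (top_Ici hD h)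
      · rintro (rfl | rfl)
        · exact ⟨a - 1, top_Iio hD h (by linarith)⟩
        · exact ⟨a, top_Ici hD h⟩
    rw [tops_eq hD, this, Set.ncard_pair]
    intro he
    have : a ∈ Set.Iio a := he ▸ Set.self_mem_Ici
    exact lt_irrefl a (Set.mem_Iio.1 this)
  · intro h
    rw [tops_eq hD, Set.ncard_eq_two] at h
    obtain ⟨S, T, hne, hST⟩ := h
    obtain ⟨x, hx⟩ : S ∈ Set.range (fun x => towerTopR (GG hD x)) := by rw [hST]; simp
    obtain ⟨y, hy⟩ : T ∈ Set.range (fun x => towerTopR (GG hD x)) := by rw [hST]; simp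
    simp only at hx hy
    have hne' : towerTopR (GG hD x) ≠ towerTopR (GG hD y) := by rwa [hx, hy]
    have : ∃ a, towerTopR (GG hD a) = Set.Ici a := by
      rcases lt_trichotomy x y with hxy | hxy | hxy
      · exact exists_top hD hxy fun hm => hne' (top_eq' hD hm).symm
      · exact absurd (by rw [hxy]) hne'
      · exact exists_top hD hxy fun hm => hne' (top_eq' hD hm)
    obtain ⟨a, ha⟩ := this
    exact ⟨a, eq_of_PP hD (PP_of_top hD ha)⟩
  · rintro a - ⟨Γ, hΓ, ht⟩
    have : a ∈ towerTopR Γ := by rw [ht]; exact Set.self_mem_Ici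
    rw [top_eq hD hΓ this] at ht
    exact eq_of_PP hD (PP_of_top hD ht)
end

section
/- Let μ be a locally finite positive Borel measure on ℝⁿ, κ ∈ ℕ, and D a dyadic grid in ℝⁿ with distinct tower tops top Γ_1, …, top Γ_T. Then the projections {E^μ_{top Γ_t;κ}}_{t=1}^T ∪ {△^μ_{Q;κ}}_{Q ∈ D} are mutually orthogonal: ⟨E^μ_{top Γ_t;κ} f, △^μ_{Q;κ} g⟩_{L²(μ)} = 0 for all t and all Q ∈ D, ⟨△^μ_{P;κ} f, △^μ_{Q;κ} g⟩_{L²(μ)} = 0 whenever P ≠ Q, and ⟨E^μ_{top Γ_s;κ} f, E^μ_{top Γ_t;κ} g⟩_{L²(μ)} = 0 whenever s ≠ t, for all f, g ∈ L²(μ). -/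
open MeasureTheory Set

noncomputable section

def IsCube {n : ℕ} (Q : Set (Fin n → ℝ)) : Prop :=
  ∃ ℓ > (0:ℝ), HasSideLength Q ℓ

def topsOf {n : ℕ} (D : Set (Set (Fin n → ℝ))) : Set (Set (Fin n → ℝ)) :=
  {S | ∃ Γ, IsTower D Γ ∧ towerTop Γ = S}

def IsChildOf {n : ℕ} (Q' Q : Set (Fin n → ℝ)) : Prop :=
  ∃ (a : Fin n → ℝ) (ℓ : ℝ) (ε : Fin n → Bool), 0 < ℓ ∧ Q = cubeOf a ℓ ∧
    Q' = cubeOf (fun i => a i + (if ε i then ℓ / 2 else 0)) (ℓ / 2)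

def IsPolyDegLT {n : ℕ} (κ : ℕ) (p : (Fin n → ℝ) → ℝ) : Prop :=
  ∃ P : MvPolynomial (Fin n) ℝ, P.totalDegree < κ ∧ ∀ x, p x = MvPolynomial.eval x P

def monomial' {n : ℕ} (β : Fin n → ℕ) : (Fin n → ℝ) → ℝ := fun x => ∏ i, (x i) ^ (β i)

def AlpertSet {n : ℕ} (μ : Measure (Fin n → ℝ)) (Q : Set (Fin n → ℝ)) (κ : ℕ) :
    Set (Lp ℝ 2 μ) :=
  {F | ∃ f : (Fin n → ℝ) → ℝ,
      (F : (Fin n → ℝ) → ℝ) =ᵐ[μ] f ∧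
      (∀ x, x ∉ Q → f x = 0) ∧
      (∀ Q', IsChildOf Q' Q → ∃ p, IsPolyDegLT κ p ∧ ∀ x ∈ Q', f x = p x) ∧
      (∀ β : Fin n → ℕ, (∑ i, β i) < κ → ∫ x in Q, f x * monomial' β x ∂μ = 0)}

def MonomialSet {n : ℕ} (μ : Measure (Fin n → ℝ)) (S : Set (Fin n → ℝ)) (κ : ℕ) :
    Set (Lp ℝ 2 μ) :=
  {F | ∃ β : Fin n → ℕ, (∑ i, β i) < κ ∧
      (F : (Fin n → ℝ) → ℝ) =ᵐ[μ] S.indicator (monomial' β)}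

def IsOrthProjOn {n : ℕ} {μ : Measure (Fin n → ℝ)} (V : Set (Lp ℝ 2 μ))
    (P : Lp ℝ 2 μ → Lp ℝ 2 μ) : Prop :=
  ∀ f, P f ∈ V ∧ ∀ g ∈ V, inner (𝕜 := ℝ) (f - P f) g = (0:ℝ)

theorem aux_nest_step {n : ℕ} {D : Set (Set (Fin n → ℝ))} (hD : IsDyadicGrid D) (i : ℕ) :
    ∀ (k : ℤ) (Q : Set (Fin n → ℝ)), Q ∈ D → HasSideLength Q ((2:ℝ) ^ k) → ∀ x ∈ Q,
      ∃ R ∈ D, HasSideLength R ((2:ℝ) ^ (k - i)) ∧ x ∈ R ∧ R ⊆ Q := by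
  induction i with
  | zero => intro k Q hQ hs x hx; exact ⟨Q, hQ, by simpa using hs, hx, subset_rfl⟩
  | succ i ih =>
    intro k Q hQ hs x hx
    obtain ⟨R, hR, hRs, hxR, hRQ⟩ := ih k Q hQ hs x hx
    obtain ⟨C, -, hCD, hCs, hU⟩ := hD.2.2 _ R hR hRs
    have hx' := hxR
    rw [hU] at hx'
    obtain ⟨S, hS, hxS⟩ := hx'
    refine ⟨S, hCD hS, ?_, hxS, ?_⟩
    · have := hCs S hS
      rwa [show k - ((i + 1 : ℕ) : ℤ) = k - i - 1 by push_cast; ring]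
    · refine subset_trans ?_ hRQ
      rw [hU]
      exact subset_sUnion_of_mem hS

theorem aux_nest {n : ℕ} {D : Set (Set (Fin n → ℝ))} (hD : IsDyadicGrid D) {j k : ℤ}
    (hjk : j ≤ k) {P Q : Set (Fin n → ℝ)} (hP : P ∈ D) (hQ : Q ∈ D)
    (hPs : HasSideLength P ((2:ℝ) ^ j)) (hQs : HasSideLength Q ((2:ℝ) ^ k))
    {x : Fin n → ℝ} (hxP : x ∈ P) (hxQ : x ∈ Q) : P ⊆ Q := by
  obtain ⟨R, hR, hRs, hxR, hRQ⟩ := aux_nest_step hD (k - j).toNat k Q hQ hQs x hxQ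
  rw [show k - ((k - j).toNat : ℤ) = j by omega] at hRs
  have := (hD.2.1 j x).unique ⟨hP, hPs, hxP⟩ ⟨hR, hRs, hxR⟩
  rw [this]; exact hRQ

theorem aux_child {n : ℕ} {D : Set (Set (Fin n → ℝ))} (hD : IsDyadicGrid D) {k : ℤ}
    {R Q : Set (Fin n → ℝ)} (hR : R ∈ D) (hQ : Q ∈ D)
    (hRs : HasSideLength R ((2:ℝ) ^ (k - 1))) (hQs : HasSideLength Q ((2:ℝ) ^ k))
    (hRQ : R ⊆ Q) : IsChildOf R Q := by
  obtain ⟨b, hb⟩ := hRs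
  obtain ⟨a, ha⟩ := hQs
  have hpos : (0:ℝ) < 2 ^ (k - 1) := by positivity
  have hk : (2:ℝ) ^ k = 2 * 2 ^ (k - 1) := by
    rw [zpow_sub₀ (by norm_num)]; ring
  set h : ℝ := 2 ^ (k - 1) with hh
  have hbR : b ∈ R := by
    rw [hb]; intro i; simp [hpos]
  have hbQ : ∀ i, a i ≤ b i ∧ b i < a i + 2 ^ k := by
    have := hRQ hbR
    rw [ha] at this; exact this
  have hle : ∀ i, b i ≤ a i + h := by
    intro i
    by_contra! hc
    have hm : Function.update b i (a i + 2 ^ k) ∈ R := by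
      rw [hb]; intro j
      by_cases hj : j = i
      · subst hj
        have := hbQ j
        simp only [Function.update_self, mem_Ico]
        constructor <;> linarith
      · simp [Function.update_of_ne hj, hpos]
    have := hRQ hm
    rw [ha] at this
    have := (this i).2
    simp at this
  have key : ∀ i, b i = a i ∨ b i = a i + h := by
    intro i
    by_contra! hc
    have h1 : b i < a i + h := lt_of_le_of_ne (hle i) hc.2
    have h2 : a i < b i := lt_of_le_of_ne (hbQ i).1 (Ne.symm hc.1)
    have hyQ : Function.update b i (a i) ∈ Q := by
      rw [ha]; intro j
      by_cases hj : j = i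
      · subst hj
        simp only [Function.update_self, mem_Ico]
        constructor <;> linarith
      · simp only [Function.update_of_ne hj]
        exact hbQ j
    obtain ⟨R', ⟨hR', ⟨b', hb'⟩, hy⟩, -⟩ := hD.2.1 (k - 1) (Function.update b i (a i))
    have hsub : R' ⊆ Q := aux_nest hD (by omega) hR' hQ ⟨b', hb'⟩ ⟨a, ha⟩ hy hyQ
    have hb'Q : b' ∈ Q := by
      apply hsub; rw [hb']; intro i; simp; positivity
    have hy2 : ∀ j, b' j ≤ Function.update b i (a i) j ∧
        Function.update b i (a i) j < b' j + h := by
      rw [hb'] at hy; exact hy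
    rw [ha] at hb'Q
    have e1 : a i ≤ b' i := (hb'Q i).1
    have e2 := (hy2 i).1
    simp only [Function.update_self] at e2
    have hbR' : b ∈ R' := by
      rw [hb']; intro j
      by_cases hj : j = i
      · subst hj
        constructor <;> linarith
      · have := hy2 j
        simp only [Function.update_of_ne hj] at this
        exact this
    have heq := (hD.2.1 (k - 1) b).unique ⟨hR, ⟨b, hb⟩, hbR⟩ ⟨hR', ⟨b', hb'⟩, hbR'⟩
    rw [← heq, hb] at hy
    have := (hy i).1
    simp only [Function.update_self] at this
    linarith
  classical
  refine ⟨a, 2 ^ k, fun i => decide (b i = a i + h), by positivity, ha, ?_⟩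
  have e : (2:ℝ) ^ k / 2 = h := by rw [hk]; ring
  rw [hb, e]
  congr 1
  funext i
  by_cases hi : b i = a i + h
  · simp [hi]
  · simp [hi]; exact (key i).resolve_right hi

theorem aux_inner {n : ℕ} {μ : Measure (Fin n → ℝ)} (F G : Lp ℝ 2 μ)
    {f g : (Fin n → ℝ) → ℝ} (hf : F =ᵐ[μ] f) (hg : G =ᵐ[μ] g) :
    inner (𝕜 := ℝ) F G = ∫ x, f x * g x ∂μ := by
  rw [L2.inner_def]
  apply integral_congr_ae
  filter_upwards [hf, hg] with x h1 h2
  simp [h1, h2, mul_comm]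

theorem aux_intble {n : ℕ} {μ : Measure (Fin n → ℝ)} [IsLocallyFiniteMeasure μ]
    (F : Lp ℝ 2 μ) {f : (Fin n → ℝ) → ℝ} (hf : F =ᵐ[μ] f) (β : Fin n → ℕ)
    {P : Set (Fin n → ℝ)} {ℓ : ℝ} (hP : HasSideLength P ℓ) :
    IntegrableOn (fun x => f x * monomial' β x) P μ := by
  obtain ⟨a, rfl⟩ := hP
  have h1 : MemLp f 2 μ := (memLp_congr_ae hf).1 (Lp.memLp F)
  have h2 : IntegrableOn f (Icc a (fun i => a i + ℓ)) μ :=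
    (h1.locallyIntegrable (by norm_num)).integrableOn_isCompact isCompact_Icc
  have hc : Continuous (monomial' β : (Fin n → ℝ) → ℝ) := by
    unfold monomial'; fun_prop
  have h3 := h2.mul_continuousOn hc.continuousOn isCompact_Icc
  refine h3.mono_set ?_
  intro x hx
  exact ⟨fun i => (hx i).1, fun i => (hx i).2.le⟩

theorem aux_poly {n : ℕ} {μ : Measure (Fin n → ℝ)} [IsLocallyFiniteMeasure μ]
    (F : Lp ℝ 2 μ) {f : (Fin n → ℝ) → ℝ} (hf : F =ᵐ[μ] f) {κ : ℕ}
    {P : Set (Fin n → ℝ)} {ℓ : ℝ} (hP : HasSideLength P ℓ)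
    (h0 : ∀ β : Fin n → ℕ, (∑ i, β i) < κ → ∫ x in P, f x * monomial' β x ∂μ = 0)
    {p : (Fin n → ℝ) → ℝ} (hp : IsPolyDegLT κ p) :
    ∫ x in P, f x * p x ∂μ = 0 := by
  obtain ⟨q, hq, hpq⟩ := hp
  have e : ∀ x, f x * p x = ∑ d ∈ q.support, q.coeff d * (f x * monomial' (⇑d) x) := by
    intro x
    rw [hpq, MvPolynomial.eval_eq', Finset.mul_sum]
    refine Finset.sum_congr rfl fun d _ => ?_
    unfold monomial'
    ring
  simp_rw [e]
  rw [integral_finsetSum]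
  · refine Finset.sum_eq_zero fun d hd => ?_
    rw [integral_const_mul, h0, mul_zero]
    have := MvPolynomial.le_totalDegree hd
    rw [Finsupp.sum_fintype _ _ (fun _ => rfl)] at this
    exact lt_of_le_of_lt this hq
  · intro d _
    exact (aux_intble F hf d hP).const_mul _

theorem aux_alpert_lt {n : ℕ} {μ : Measure (Fin n → ℝ)} [IsLocallyFiniteMeasure μ] {κ : ℕ}
    {D : Set (Set (Fin n → ℝ))} (hD : IsDyadicGrid D) {j k : ℤ}
    (hjk : j < k) {P Q : Set (Fin n → ℝ)} (hP : P ∈ D) (hQ : Q ∈ D)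
    (hPs : HasSideLength P ((2:ℝ) ^ j)) (hQs : HasSideLength Q ((2:ℝ) ^ k))
    {F G : Lp ℝ 2 μ} (hF : F ∈ AlpertSet μ P κ) (hG : G ∈ AlpertSet μ Q κ) :
    inner (𝕜 := ℝ) F G = (0:ℝ) := by
  obtain ⟨f, hf, hf0, -, hfm⟩ := hF
  obtain ⟨g, hg, hg0, hgc, -⟩ := hG
  rw [aux_inner F G hf hg]
  by_cases hd : ∃ x, x ∈ P ∧ x ∈ Q
  · obtain ⟨x, hxP, hxQ⟩ := hd
    obtain ⟨R, hR, hRs, hxR, hRQ⟩ := aux_nest_step hD 1 k Q hQ hQs x hxQ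
    norm_num at hRs
    have hPR : P ⊆ R := aux_nest hD (by omega) hP hR hPs hRs hxP hxR
    obtain ⟨p, hp, hpe⟩ := hgc R (aux_child hD hR hQ hRs hQs hRQ)
    rw [← aux_poly F hf hPs hfm hp,
      setIntegral_eq_integral_of_forall_compl_eq_zero (fun x hx => by simp [hf0 x hx])]
    congr 1
    funext x
    by_cases hx : x ∈ P
    · rw [hpe x (hPR hx)]
    · simp [hf0 x hx]
  · push Not at hd
    have : ∀ x, f x * g x = 0 := by
      intro x
      by_cases hx : x ∈ P
      · simp [hg0 x (hd x hx)]
      · simp [hf0 x hx]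
    simp [this]

theorem aux_tower_mem {n : ℕ} {D : Set (Set (Fin n → ℝ))} {Γ : ℕ → Set (Fin n → ℝ)}
    (h : IsTower D Γ) : Monotone Γ := monotone_nat_of_le_succ h.2.1

theorem aux_tower_side {n : ℕ} {D : Set (Set (Fin n → ℝ))} {Γ : ℕ → Set (Fin n → ℝ)}
    (h : IsTower D Γ) (m : ℕ) : HasSideLength (Γ m) ((2:ℝ) ^ ((m : ℤ) + 1)) := by
  have := h.2.2 m
  rwa [← zpow_natCast, Nat.cast_succ] at this

theorem aux_top_eq {n : ℕ} {D : Set (Set (Fin n → ℝ))} (hD : IsDyadicGrid D)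
    {Γ Γ' : ℕ → Set (Fin n → ℝ)} (h : IsTower D Γ) (h' : IsTower D Γ') {x : Fin n → ℝ}
    (hx : x ∈ towerTop Γ) (hx' : x ∈ towerTop Γ') : towerTop Γ ⊆ towerTop Γ' := by
  obtain ⟨m, hm⟩ := mem_iUnion.1 hx
  obtain ⟨m', hm'⟩ := mem_iUnion.1 hx'
  intro y hy
  obtain ⟨l, hl⟩ := mem_iUnion.1 hy
  set M := max m (max m' l) with hM
  have e : Γ M ⊆ Γ' M := aux_nest hD le_rfl (h.1 M) (h'.1 M) (aux_tower_side h M)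
    (aux_tower_side h' M) (aux_tower_mem h (by omega) hm) (aux_tower_mem h' (by omega) hm')
  exact mem_iUnion.2 ⟨M, e (aux_tower_mem h (by omega) hl)⟩

theorem aux_cube_top {n : ℕ} {D : Set (Set (Fin n → ℝ))} (hD : IsDyadicGrid D)
    {Γ : ℕ → Set (Fin n → ℝ)} (h : IsTower D Γ) {Q : Set (Fin n → ℝ)} (hQ : Q ∈ D)
    {x : Fin n → ℝ} (hx : x ∈ towerTop Γ) (hxQ : x ∈ Q) : Q ⊆ towerTop Γ := by
  obtain ⟨m, hm⟩ := mem_iUnion.1 hx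
  obtain ⟨k, hk⟩ := hD.1 Q hQ
  set M := max m k.toNat with hM
  have e : Q ⊆ Γ M := aux_nest hD (by omega) hQ (h.1 M) hk
    (aux_tower_side h M) hxQ (aux_tower_mem h (by omega) hm)
  exact fun y hy => mem_iUnion.2 ⟨M, e hy⟩

theorem aux_span {n : ℕ} {μ : Measure (Fin n → ℝ)} {A : Set (Lp ℝ 2 μ)} {G : Lp ℝ 2 μ}
    (h : ∀ F ∈ A, inner (𝕜 := ℝ) F G = (0:ℝ)) {F : Lp ℝ 2 μ} (hF : F ∈ Submodule.span ℝ A) :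
    inner (𝕜 := ℝ) F G = (0:ℝ) := by
  induction hF using Submodule.span_induction with
  | mem x hx => exact h x hx
  | zero => exact inner_zero_left _
  | add x y _ _ hx hy => rw [inner_add_left, hx, hy, add_zero]
  | smul c x _ hx => rw [real_inner_smul_left, hx, mul_zero]

/-- The projections `E^μ_{top Γ_t;κ}`, `t = 1, …, T`, onto the polynomial spaces of the distinct
tower tops, and `△^μ_{Q;κ}`, `Q ∈ D`, onto the Alpert spaces of the cubes of `D`, are mutually
orthogonal. -/
theorem alpert_projections_mutually_orthogonal (n : ℕ) (μ : Measure (Fin n → ℝ))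
    [IsLocallyFiniteMeasure μ] (κ : ℕ) (D : Set (Set (Fin n → ℝ))) (hD : IsDyadicGrid D)
    (T : ℕ) (Γ : Fin T → ℕ → Set (Fin n → ℝ))
    (hΓ : ∀ t, IsTower D (Γ t))
    (hdistinct : ∀ s t, s ≠ t → towerTop (Γ s) ≠ towerTop (Γ t))
    (hall : ∀ Γ', IsTower D Γ' → ∃ t, towerTop Γ' = towerTop (Γ t))
    (E : Fin T → Lp ℝ 2 μ → Lp ℝ 2 μ)
    (hE : ∀ t, IsOrthProjOn
      (Submodule.span ℝ (MonomialSet μ (towerTop (Γ t)) κ) : Set (Lp ℝ 2 μ)) (E t))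
    (Δ : Set (Fin n → ℝ) → Lp ℝ 2 μ → Lp ℝ 2 μ)
    (hΔ : ∀ Q ∈ D, IsOrthProjOn (AlpertSet μ Q κ) (Δ Q)) :
    (∀ t, ∀ Q ∈ D, ∀ f g : Lp ℝ 2 μ, inner (𝕜 := ℝ) (E t f) (Δ Q g) = (0:ℝ)) ∧
    (∀ P Q, P ∈ D → Q ∈ D → P ≠ Q →
      ∀ f g : Lp ℝ 2 μ, inner (𝕜 := ℝ) (Δ P f) (Δ Q g) = (0:ℝ)) ∧
    (∀ s t, s ≠ t → ∀ f g : Lp ℝ 2 μ, inner (𝕜 := ℝ) (E s f) (E t g) = (0:ℝ)) := by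
  refine ⟨?_, ?_, ?_⟩
  · intro t Q hQ f g
    refine aux_span ?_ (hE t f).1
    rintro F ⟨β, hβ, hF⟩
    obtain ⟨u, hu, hu0, -, hum⟩ := (hΔ Q hQ g).1
    rw [aux_inner _ _ hF hu]
    by_cases hd : ∃ x, x ∈ towerTop (Γ t) ∧ x ∈ Q
    · obtain ⟨x, hx, hxQ⟩ := hd
      have hs := aux_cube_top hD (hΓ t) hQ hx hxQ
      rw [← hum β hβ,
        setIntegral_eq_integral_of_forall_compl_eq_zero (fun x hx => by simp [hu0 x hx])]
      congr 1
      funext x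
      by_cases hx : x ∈ Q
      · rw [indicator_of_mem (hs hx), mul_comm]
      · simp [hu0 x hx]
    · push Not at hd
      have : ∀ x, (towerTop (Γ t)).indicator (monomial' β) x * u x = 0 := by
        intro x
        by_cases hx : x ∈ towerTop (Γ t)
        · simp [hu0 x (hd x hx)]
        · simp [hx]
      simp [this]
  · intro P Q hP hQ hne f g
    obtain ⟨j, hj⟩ := hD.1 P hP
    obtain ⟨k, hk⟩ := hD.1 Q hQ
    have hF := (hΔ P hP f).1
    have hG := (hΔ Q hQ g).1
    rcases lt_trichotomy j k with h | h | h
    · exact aux_alpert_lt hD h hP hQ hj hk hF hG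
    · subst h
      obtain ⟨u, hu, hu0, -, -⟩ := hF
      obtain ⟨v, hv, hv0, -, -⟩ := hG
      rw [aux_inner _ _ hu hv]
      have : ∀ x, u x * v x = 0 := by
        intro x
        by_cases hx : x ∈ P
        · have : x ∉ Q := fun hxQ => hne
            ((hD.2.1 j x).unique ⟨hP, hj, hx⟩ ⟨hQ, hk, hxQ⟩)
          simp [hv0 x this]
        · simp [hu0 x hx]
      simp [this]
    · rw [real_inner_comm]
      exact aux_alpert_lt hD h hQ hP hk hj hG hF
  · intro s t hst f g
    refine aux_span ?_ (hE s f).1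
    rintro F ⟨β, hβ, hF⟩
    rw [real_inner_comm]
    refine aux_span ?_ (hE t g).1
    rintro G ⟨γ, hγ, hG⟩
    rw [aux_inner _ _ hG hF]
    have : ∀ x, (towerTop (Γ t)).indicator (monomial' γ) x *
        (towerTop (Γ s)).indicator (monomial' β) x = 0 := by
      intro x
      by_cases hx : x ∈ towerTop (Γ t)
      · have : x ∉ towerTop (Γ s) := fun hx' => hdistinct s t hst
          (subset_antisymm (aux_top_eq hD (hΓ s) (hΓ t) hx' hx)
            (aux_top_eq hD (hΓ t) (hΓ s) hx hx'))
        simp [this]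
      · simp [hx]
    simp [this]

end
end

section
/- Let μ be a doubling positive Borel measure on ℝⁿ and κ ∈ ℕ. Then there is a constant C, depending only on n, κ and the doubling constant of μ, such that for every half-open axis-parallel cube I and every f ∈ L²(μ): ‖△^μ_{I;κ} f‖_{L²(μ)} ≤ ‖△^μ_{I;κ} f‖_{L^∞(μ)} · μ(I)^{1/2} ≤ C ‖△^μ_{I;κ} f‖_{L²(μ)}. -/
open MeasureTheory Set

noncomputable section

/-- `μ` is a doubling measure with doubling constant `C`: `μ(2Q) ≤ C μ(Q)` for every cube `Q`
(`2Q` the concentric double), and `μ ≠ 0`. -/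
def IsDoubling {n : ℕ} (μ : Measure (Fin n → ℝ)) (C : ℝ) : Prop :=
  μ ≠ 0 ∧ ∀ (a : Fin n → ℝ) (ℓ : ℝ), 0 < ℓ →
    μ (cubeOf (fun i => a i - ℓ / 2) (2 * ℓ)) ≤ ENNReal.ofReal C * μ (cubeOf a ℓ)


theorem aux_deg {n : ℕ} (κ : ℕ) (P : MvPolynomial (Fin n) ℝ) (hP : P.totalDegree < κ)
    (a : Fin n → ℝ) (s : ℝ) :
    ∃ Q : MvPolynomial (Fin n) ℝ, Q.totalDegree < κ ∧
      ∀ x, MvPolynomial.eval x Q = MvPolynomial.eval (fun i => a i + s * x i) P := by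
  refine ⟨MvPolynomial.aeval (fun i => MvPolynomial.C (a i) + MvPolynomial.C s * MvPolynomial.X i) P,
    lt_of_le_of_lt ?_ hP, ?_⟩
  · rw [MvPolynomial.aeval_def, MvPolynomial.eval₂_eq]
    refine MvPolynomial.totalDegree_finsetSum_le fun d hd => ?_
    refine (MvPolynomial.totalDegree_mul _ _).trans ?_
    have h1 : (algebraMap ℝ (MvPolynomial (Fin n) ℝ) (P.coeff d)).totalDegree = 0 :=
      MvPolynomial.totalDegree_C _
    rw [h1, zero_add]
    refine (MvPolynomial.totalDegree_finsetProd _ _).trans ?_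
    refine le_trans ?_ (MvPolynomial.le_totalDegree hd)
    rw [Finsupp.sum]
    refine Finset.sum_le_sum fun i _ => ?_
    refine (MvPolynomial.totalDegree_pow _ _).trans ?_
    have h2 : (MvPolynomial.C (a i) + MvPolynomial.C s * MvPolynomial.X i :
        MvPolynomial (Fin n) ℝ).totalDegree ≤ 1 := by
      refine (MvPolynomial.totalDegree_add _ _).trans (max_le (by simp) ?_)
      refine (MvPolynomial.totalDegree_mul _ _).trans (by simp)
    calc _ ≤ d i * 1 := Nat.mul_le_mul_left _ h2
      _ = d i := mul_one _
  · intro x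
    have h := MvPolynomial.aeval_def (fun i => MvPolynomial.C (a i) + MvPolynomial.C s * MvPolynomial.X i) P
    rw [h, MvPolynomial.eval₂_eq, map_sum, MvPolynomial.eval_eq]
    refine Finset.sum_congr rfl fun d _ => ?_
    rw [map_mul, map_prod]
    simp only [map_pow, map_add, map_mul, MvPolynomial.eval_C, MvPolynomial.eval_X,
      MvPolynomial.algebraMap_eq]

def polyC (n : ℕ) : MvPolynomial (Fin n) ℝ →ₗ[ℝ] C(Set.Icc (0 : Fin n → ℝ) 1, ℝ) where
  toFun P := ⟨fun x => MvPolynomial.eval (x : Fin n → ℝ) P,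
    (MvPolynomial.continuous_eval P).comp continuous_subtype_val⟩
  map_add' P Q := by ext; simp
  map_smul' c P := by ext; simp

theorem aux_delta (n κ : ℕ) : ∃ δ > 0, ∀ P : MvPolynomial (Fin n) ℝ, P.totalDegree < κ →
    ∀ x y : Set.Icc (0 : Fin n → ℝ) 1, dist x y < δ →
      |polyC n P x - polyC n P y| ≤ ‖polyC n P‖ / 2 := by
  have hfin : FiniteDimensional ℝ (MvPolynomial.restrictTotalDegree (Fin n) ℝ κ) := by
    infer_instance
  set E := (MvPolynomial.restrictTotalDegree (Fin n) ℝ κ).map (polyC n) with hE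
  have hfE : FiniteDimensional ℝ E := by rw [hE]; infer_instance
  have : ProperSpace E := FiniteDimensional.proper ℝ E
  have hK : IsCompact ((Metric.closedBall (0 : E) 1) ×ˢ (univ : Set (Set.Icc (0 : Fin n → ℝ) 1))) :=
    (isCompact_closedBall _ _).prod isCompact_univ
  have hc : Continuous (fun q : E × Set.Icc (0 : Fin n → ℝ) 1 => (q.1 : C(_, ℝ)) q.2) := by
    fun_prop
  have hu := hK.uniformContinuousOn_of_continuous hc.continuousOn
  rw [Metric.uniformContinuousOn_iff] at hu
  obtain ⟨δ, hδ, h⟩ := hu (1/2) (by norm_num)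
  refine ⟨δ, hδ, fun P hP x y hxy => ?_⟩
  by_cases h0 : polyC n P = 0
  · simp [h0]
  have hn : 0 < ‖polyC n P‖ := norm_pos_iff.mpr h0
  let q : E := ⟨‖polyC n P‖⁻¹ • polyC n P, Submodule.smul_mem _ _
    (Submodule.mem_map_of_mem ((MvPolynomial.mem_restrictTotalDegree _ _ _).mpr hP.le))⟩
  have hq : q ∈ Metric.closedBall (0 : E) 1 := by
    rw [mem_closedBall_zero_iff]
    change ‖‖polyC n P‖⁻¹ • polyC n P‖ ≤ 1
    rw [norm_smul, norm_inv, norm_norm, inv_mul_cancel₀ hn.ne']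
  have := h (q, x) ⟨hq, mem_univ _⟩ (q, y) ⟨hq, mem_univ _⟩ (by simpa [Prod.dist_eq, hδ] using hxy)
  rw [Real.dist_eq] at this
  have e : (q : C(_, ℝ)) x - (q : C(_, ℝ)) y = ‖polyC n P‖⁻¹ * (polyC n P x - polyC n P y) := by
    simp [q, mul_sub]
  simp only [e, abs_mul, abs_inv, abs_norm] at this
  rw [inv_mul_lt_iff₀ hn] at this
  linarith

theorem aux_key (n κ : ℕ) : ∃ m : ℕ, ∀ P : MvPolynomial (Fin n) ℝ, P.totalDegree < κ →
    ∃ b : Fin n → ℝ, (∀ i, 0 ≤ b i ∧ b i + (1/2)^m ≤ 1) ∧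
      ∀ x y : Fin n → ℝ, (∀ i, 0 ≤ x i ∧ x i ≤ 1) → (∀ i, b i ≤ y i ∧ y i ≤ b i + (1/2)^m) →
        |MvPolynomial.eval x P| ≤ 2 * |MvPolynomial.eval y P| := by
  obtain ⟨δ, hδ, h⟩ := aux_delta n κ
  obtain ⟨m, hm⟩ := exists_pow_lt_of_lt_one hδ (by norm_num : (1/2:ℝ) < 1)
  refine ⟨m, fun P hP => ?_⟩
  have : Nonempty (Set.Icc (0 : Fin n → ℝ) 1) := ⟨⟨0, by simp⟩⟩
  obtain ⟨z, -, hz⟩ := isCompact_univ.exists_isMaxOn (univ_nonempty)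
    (f := fun x => |polyC n P x|) (by fun_prop : Continuous _).continuousOn
  have hN : ‖polyC n P‖ ≤ |polyC n P z| := by
    rw [ContinuousMap.norm_le _ (abs_nonneg _)]
    intro x
    exact hz (mem_univ x)
  have hp : (0:ℝ) < (1/2)^m := by positivity
  have hp1 : ((1:ℝ)/2)^m ≤ 1 := pow_le_one₀ (by norm_num) (by norm_num)
  have hz0 : ∀ i, 0 ≤ z.1 i := fun i => z.2.1 i
  have hz1 : ∀ i, z.1 i ≤ 1 := fun i => z.2.2 i
  refine ⟨fun i => min (z.1 i) (1 - (1/2)^m), fun i => ⟨le_min (hz0 i) (by linarith), ?_⟩, ?_⟩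
  · linarith [min_le_right (z.1 i) (1 - (1/2)^m)]
  intro x y hx hy
  have hb0 : ∀ i, 0 ≤ min (z.1 i) (1 - (1/2)^m) := fun i => le_min (hz0 i) (by linarith)
  have hyK : y ∈ Set.Icc (0 : Fin n → ℝ) 1 :=
    ⟨fun i => (hb0 i).trans (hy i).1, fun i => by
      have := (hy i).2
      have h2 := min_le_right (z.1 i) (1 - (1/2)^m)
      simp only [Pi.one_apply]; linarith⟩
  have hxK : x ∈ Set.Icc (0 : Fin n → ℝ) 1 := ⟨fun i => (hx i).1, fun i => (hx i).2⟩
  have hd : dist z ⟨y, hyK⟩ < δ := by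
    refine lt_of_le_of_lt ?_ hm
    rw [Subtype.dist_eq, dist_pi_le_iff hp.le]
    intro i
    have h1 := hy i
    beta_reduce at h1
    rw [Real.dist_eq, abs_le]
    have := hz1 i
    rcases min_cases (z.1 i) (1 - (1/2)^m) with ⟨e, _⟩ | ⟨e, _⟩ <;> rw [e] at h1 <;>
      constructor <;> linarith [h1.1, h1.2]
  have h1 := h P hP _ _ hd
  have h2 : |polyC n P ⟨x, hxK⟩| ≤ |polyC n P z| := hz (mem_univ _)
  have h3 : |polyC n P z| ≤ |polyC n P z - polyC n P ⟨y, hyK⟩| + |polyC n P ⟨y, hyK⟩| := by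
    have := abs_add_le (polyC n P z - polyC n P ⟨y, hyK⟩) (polyC n P ⟨y, hyK⟩)
    simpa using this
  have h4 : ‖polyC n P‖ = |polyC n P z| := le_antisymm hN ((polyC n P).norm_coe_le_norm z)
  change |polyC n P ⟨x, hxK⟩| ≤ 2 * |polyC n P ⟨y, hyK⟩|
  linarith

theorem aux_meas {n : ℕ} (a : Fin n → ℝ) (ℓ : ℝ) : MeasurableSet (cubeOf a ℓ) := by
  have : cubeOf a ℓ = Set.pi univ (fun i => Set.Ico (a i) (a i + ℓ)) := by
    ext; simp [cubeOf]
  rw [this]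
  exact MeasurableSet.univ_pi fun i => measurableSet_Ico

theorem aux_fin {n : ℕ} (μ : Measure (Fin n → ℝ)) [IsLocallyFiniteMeasure μ]
    (a : Fin n → ℝ) (ℓ : ℝ) : μ (cubeOf a ℓ) ≠ ⊤ := by
  refine ((measure_mono ?_).trans_lt
    (isCompact_Icc (a := a) (b := fun i => a i + ℓ)).measure_lt_top).ne
  exact fun x hx => ⟨fun i => (hx i).1, fun i => (hx i).2.le⟩

theorem aux_doub {n : ℕ} (μ : Measure (Fin n → ℝ)) {C : ℝ} (h : IsDoubling μ C)
    (a : Fin n → ℝ) {ℓ : ℝ} (hℓ : 0 < ℓ) (k : ℕ) :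
    μ (cubeOf (fun i => a i - (2^k - 1) * ℓ / 2) (2^k * ℓ)) ≤
      ENNReal.ofReal C ^ k * μ (cubeOf a ℓ) := by
  induction k with
  | zero => simp
  | succ k ih =>
    have := h.2 (fun i => a i - (2^k - 1) * ℓ / 2) (2^k * ℓ) (by positivity)
    have e : cubeOf (fun i => a i - (2^(k+1) - 1) * ℓ / 2) (2^(k+1) * ℓ) =
      cubeOf (fun i => a i - (2^k - 1) * ℓ / 2 - 2^k * ℓ / 2) (2 * (2^k * ℓ)) := by
      congr 1
      · ext i; ring
      · ring
    rw [e]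
    refine this.trans ?_
    rw [pow_succ', mul_assoc]
    gcongr

/-- For a doubling measure `μ`, there is a constant `C` (depending only on `n`, `κ` and the
doubling constant) such that for every cube `I` and `f ∈ L²(μ)`,
`‖△^μ_{I;κ} f‖_{L²(μ)} ≤ ‖△^μ_{I;κ} f‖_{L^∞(μ)} μ(I)^{1/2} ≤ C ‖△^μ_{I;κ} f‖_{L²(μ)}`. -/
theorem alpert_coefficient_comparability (n κ : ℕ) (Cμ : ℝ) :
    ∃ C : ℝ, 0 ≤ C ∧
      ∀ (μ : Measure (Fin n → ℝ)) [IsLocallyFiniteMeasure μ], IsDoubling μ Cμ →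
        ∀ (a : Fin n → ℝ) (ℓ : ℝ), 0 < ℓ →
          ∀ Δ : Lp ℝ 2 μ → Lp ℝ 2 μ, IsOrthProjOn (AlpertSet μ (cubeOf a ℓ) κ) Δ →
            ∀ f : Lp ℝ 2 μ,
              eLpNorm (Δ f : (Fin n → ℝ) → ℝ) 2 μ ≤
                  eLpNorm (Δ f : (Fin n → ℝ) → ℝ) ⊤ μ * (μ (cubeOf a ℓ)) ^ (1/2 : ℝ) ∧
                eLpNorm (Δ f : (Fin n → ℝ) → ℝ) ⊤ μ * (μ (cubeOf a ℓ)) ^ (1/2 : ℝ) ≤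
                  ENNReal.ofReal C * eLpNorm (Δ f : (Fin n → ℝ) → ℝ) 2 μ := by
  obtain ⟨m, hm⟩ := aux_key n κ
  refine ⟨(2 * (ENNReal.ofReal Cμ ^ (m+2)) ^ (1/2:ℝ)).toReal, ENNReal.toReal_nonneg, ?_⟩
  intro μ _ hμ a ℓ hℓ Δ hΔ f
  rw [ENNReal.ofReal_toReal (ENNReal.mul_ne_top (by simp) (ENNReal.rpow_ne_top_of_nonneg
    (by norm_num) (ENNReal.pow_ne_top ENNReal.ofReal_ne_top)))]
  obtain ⟨g, hfg, hg0, hgp, -⟩ := (hΔ f).1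
  have hgm : AEStronglyMeasurable g μ := (Lp.aestronglyMeasurable (Δ f)).congr hfg
  rw [eLpNorm_congr_ae hfg, eLpNorm_congr_ae hfg]
  clear hfg hΔ
  have hIm := aux_meas a ℓ
  have hIf := aux_fin μ a ℓ
  constructor
  · have hgi : (cubeOf a ℓ).indicator g = g := by
      rw [Set.indicator_eq_self]
      intro x hx
      by_contra h
      exact hx (hg0 x h)
    have h1 : eLpNorm g 2 μ = eLpNorm g 2 (μ.restrict (cubeOf a ℓ)) := by
      rw [← eLpNorm_indicator_eq_eLpNorm_restrict hIm, hgi]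
    rw [h1]
    refine (eLpNorm_le_eLpNorm_mul_rpow_measure_univ (le_top : (2:ENNReal) ≤ ⊤) hgm.restrict).trans ?_
    have e : (1 / (2:ENNReal).toReal - 1 / (⊤:ENNReal).toReal) = (1/2:ℝ) := by simp
    rw [e, Measure.restrict_apply_univ]
    gcongr
    exact Measure.restrict_le_self
  · by_cases hI0 : μ (cubeOf a ℓ) = 0
    · simp [hI0]
    have hpt : ∀ x ∈ cubeOf a ℓ, ‖g x‖ₑ * μ (cubeOf a ℓ) ^ (1/2:ℝ) ≤
        2 * (ENNReal.ofReal Cμ ^ (m+2)) ^ (1/2:ℝ) * eLpNorm g 2 μ := by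
      intro x hx
      set ε : Fin n → Bool := fun i => decide (a i + ℓ/2 ≤ x i) with hε
      set a' : Fin n → ℝ := fun i => a i + (if ε i then ℓ / 2 else 0) with ha'
      have ha1 : ∀ i, a i ≤ a' i ∧ a' i ≤ a i + ℓ / 2 := by
        intro i; simp only [ha']; split_ifs <;> constructor <;> linarith
      have hxc : x ∈ cubeOf a' (ℓ/2) := by
        intro i
        have := hx i
        simp only [mem_Ico] at this
        by_cases h : a i + ℓ/2 ≤ x i
        · have e : a' i = a i + ℓ/2 := by simp [ha', hε, h]
          rw [e, mem_Ico]
          constructor <;> linarith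
        · have e : a' i = a i := by simp [ha', hε, h]
          rw [e, mem_Ico]
          push Not at h
          constructor <;> linarith
      obtain ⟨p, ⟨P, hP, hpP⟩, hgp'⟩ := hgp (cubeOf a' (ℓ/2)) ⟨a, ℓ, ε, hℓ, rfl, rfl⟩
      obtain ⟨Q, hQ, hQP⟩ := aux_deg κ P hP a' (ℓ/2)
      obtain ⟨b, hb, hbP⟩ := hm Q hQ
      have hp : (0:ℝ) < (1/2)^m := by positivity
      set s : ℝ := (1/2)^m with hs
      set R := cubeOf (fun i => a' i + ℓ/2 * b i) (ℓ/2 * s) with hR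
      have hl2 : 0 < ℓ/2 := by linarith
      have hRs : R ⊆ cubeOf a' (ℓ/2) := by
        intro y hy i
        have h1 := hy i
        have h2 := hb i
        simp only [mem_Ico] at h1 ⊢
        constructor <;> nlinarith
      have hval : ∀ y ∈ cubeOf a' (ℓ/2), g y = MvPolynomial.eval (fun i => (y i - a' i) / (ℓ/2)) Q := by
        intro y hy
        rw [hgp' y hy, hpP, hQP]
        congr 2
        ext i
        rw [mul_div_cancel₀ _ hl2.ne']; ring
      have hRg : ∀ y ∈ R, |g x| ≤ 2 * |g y| := by
        intro y hy
        rw [hval x hxc, hval y (hRs hy)]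
        apply hbP
        · intro i
          have := hxc i
          simp only [mem_Ico] at this
          rw [le_div_iff₀ hl2, div_le_iff₀ hl2]
          constructor <;> linarith
        · intro i
          have := hy i
          simp only [mem_Ico] at this
          rw [le_div_iff₀ hl2, div_le_iff₀ hl2]
          constructor <;> nlinarith
      have hRm : MeasurableSet R := aux_meas _ _
      have hd := aux_doub μ hμ (fun i => a' i + ℓ/2 * b i) (mul_pos hl2 hp) (m+2)
      have h2s : (2:ℝ)^(m+2) * (ℓ/2*s) = 2 * ℓ := by
        have : (2:ℝ)^m * s = 1 := by rw [hs, ← mul_pow]; norm_num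
        rw [pow_add]; linear_combination 2 * ℓ * this
      have hIR : μ (cubeOf a ℓ) ≤ ENNReal.ofReal Cμ ^ (m+2) * μ R := by
        refine (measure_mono ?_).trans hd
        intro y hy i
        have h1 := hy i
        have h2 := hb i
        have h3 := ha1 i
        have h4 : 0 < ℓ/2 * s := mul_pos hl2 hp
        have h5 : ℓ/2 * b i ≤ ℓ/2 - ℓ/2 * s := by nlinarith
        have h6 : 0 ≤ ℓ/2 * b i := mul_nonneg hl2.le h2.1
        have h7 : ((2:ℝ)^(m+2) - 1) * (ℓ/2*s) = 2 * ℓ - ℓ/2*s := by linear_combination h2s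
        simp only [mem_Ico] at h1 ⊢
        rw [h7, h2s]
        constructor <;> linarith
      have hlow : ‖g x‖ₑ * μ R ^ (1/2:ℝ) ≤ 2 * eLpNorm g 2 μ := by
        have e1 : eLpNorm (R.indicator fun _ => g x) 2 μ = ‖g x‖ₑ * μ R ^ (1/2:ℝ) := by
          rw [eLpNorm_indicator_const hRm (by simp) (by simp)]; simp
        have e2 : eLpNorm ((2:ℝ) • g) 2 μ = 2 * eLpNorm g 2 μ := by
          rw [eLpNorm_const_smul]; congr 1
          simp [Real.enorm_eq_ofReal]
        rw [← e1, ← e2]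
        refine eLpNorm_mono fun y => ?_
        by_cases hy : y ∈ R
        · simpa [hy] using hRg y hy
        · simp [hy]
      calc ‖g x‖ₑ * μ (cubeOf a ℓ) ^ (1/2:ℝ)
          ≤ ‖g x‖ₑ * (ENNReal.ofReal Cμ ^ (m+2) * μ R) ^ (1/2:ℝ) := by gcongr
        _ = (ENNReal.ofReal Cμ ^ (m+2)) ^ (1/2:ℝ) * (‖g x‖ₑ * μ R ^ (1/2:ℝ)) := by
          rw [ENNReal.mul_rpow_of_nonneg _ _ (by norm_num)]; ring
        _ ≤ (ENNReal.ofReal Cμ ^ (m+2)) ^ (1/2:ℝ) * (2 * eLpNorm g 2 μ) := by gcongr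
        _ = _ := by ring
    apply ENNReal.mul_le_of_le_div
    rw [eLpNorm_exponent_top]
    refine eLpNormEssSup_le_of_ae_enorm_bound (Filter.Eventually.of_forall fun x => ?_)
    by_cases hx : x ∈ cubeOf a ℓ
    · rw [ENNReal.le_div_iff_mul_le]
      · exact hpt x hx
      · left; simp [hI0, hIf]
      · left; simp [hI0, hIf]
    · simp [hg0 x hx]

end
end
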